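/- arXiv:2005.13620 — 2 statements merged into one kernel-verified Lean document; each statement's English description precedes it below -/
import Mathlib

section
/- For |q| < 1, the triple sum ∑_{n₁,n₂,n₃≥0} q^{n₁+n₂+n₃+n₁n₂+n₂n₃} / ((q;q)_{n₁} (q;q)_{n₂} (q;q)_{n₃}²) equals (∑_{n≥0} (-1)ⁿ q^{n(n+3)/2}) / (q;q)_∞³. -/
/-- The finite q-Pochhammer symbol `(q;q)_n`. -/
noncomputable def qPoch (q : ℂ) (n : ℕ) : ℂ := ∏ i ∈ Finset.range n, (1 - q ^ (i + 1))

/-- The infinite q-Pochhammer symbol `(q;q)_∞`. -/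
noncomputable def qPochInf (q : ℂ) : ℂ := ∏' i : ℕ, (1 - q ^ (i + 1))

/-- The infinite q-Pochhammer symbol `(a;q)_∞ = ∏_{i≥0} (1 - a q^i)`. -/
noncomputable def pochInf (a q : ℂ) : ℂ := ∏' i : ℕ, (1 - a * q ^ i)

open Filter Topology

lemma aux_summ {a : ℕ → ℂ} {C : ℝ} (ha : ∀ n, ‖a n‖ ≤ C) {q : ℂ} (hq : ‖q‖ < 1) (m : ℕ) :
    Summable (fun n => a n * q ^ (n * (m + 1))) := by
  refine Summable.of_norm_bounded (g := fun n => C * ‖q‖ ^ n)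
    ((summable_geometric_of_lt_one (norm_nonneg _) hq).mul_left C) ?_
  intro n
  rw [norm_mul, norm_pow]
  refine mul_le_mul (ha n) ?_ (by positivity) ((norm_nonneg _).trans (ha n))
  exact pow_le_pow_of_le_one (norm_nonneg _) hq.le (by nlinarith)

lemma aux_lim {a : ℕ → ℂ} {C : ℝ} (ha : ∀ n, ‖a n‖ ≤ C) {q : ℂ} (hq : ‖q‖ < 1) :
    Tendsto (fun m => ∑' n, a n * q ^ (n * (m + 1))) atTop (𝓝 (a 0)) := by
  have h0 : ∑' n, (if n = 0 then a 0 else 0) = a 0 := by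
    rw [tsum_ite_eq]
  rw [← h0]
  refine tendsto_tsum_of_dominated_convergence (bound := fun n => C * ‖q‖ ^ n)
    ((summable_geometric_of_lt_one (norm_nonneg _) hq).mul_left C) ?_ ?_
  · intro n
    rcases Nat.eq_zero_or_pos n with rfl | hn
    · simp
    · rw [if_neg hn.ne']
      have h1 : Tendsto (fun m : ℕ => q ^ (n * (m + 1))) atTop (𝓝 0) := by
        refine (tendsto_pow_atTop_nhds_zero_of_norm_lt_one hq).comp ?_
        refine tendsto_atTop_mono (fun m => ?_) tendsto_id
        simp only [id]
        nlinarith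
      simpa using h1.const_mul (a n)
  · refine Eventually.of_forall fun m n => ?_
    rw [norm_mul, norm_pow]
    refine mul_le_mul (ha n) ?_ (by positivity) ((norm_nonneg _).trans (ha n))
    exact pow_le_pow_of_le_one (norm_nonneg _) hq.le (by nlinarith)

lemma one_sub_ne {q : ℂ} (hq : ‖q‖ < 1) (i : ℕ) : (1 - q ^ (i + 1)) ≠ 0 := by
  intro h
  have h1 : ‖q ^ (i + 1)‖ < 1 := by
    rw [norm_pow]; exact pow_lt_one₀ (norm_nonneg _) hq (by omega)
  rw [← sub_eq_zero.mp h] at h1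
  simp at h1

lemma qPoch_succ (q : ℂ) (n : ℕ) : qPoch q (n + 1) = qPoch q n * (1 - q ^ (n + 1)) := by
  simp [qPoch, Finset.prod_range_succ]

lemma qPoch_ne {q : ℂ} (hq : ‖q‖ < 1) (n : ℕ) : qPoch q n ≠ 0 :=
  Finset.prod_ne_zero_iff.mpr fun i _ => one_sub_ne hq i

lemma qPoch_tendsto {q : ℂ} (hq : ‖q‖ < 1) :
    Tendsto (qPoch q) atTop (𝓝 (qPochInf q)) := by
  have h : Multipliable fun n : ℕ ↦ 1 - q ^ (n + 1) := by
    apply multipliable_one_add_of_summable (f := fun n ↦ -q ^ (n + 1))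
    simpa using (summable_nat_add_iff 1).mpr (summable_geometric_of_lt_one (norm_nonneg _) hq)
  exact h.tendsto_prod_tprod_nat

lemma qPochInf_ne {q : ℂ} (hq : ‖q‖ < 1) : qPochInf q ≠ 0 := by
  have := tprod_one_add_ne_zero_of_summable (f := fun n : ℕ ↦ -q ^ (n + 1))
    (fun i => by simpa [sub_eq_add_neg] using one_sub_ne hq i)
    (by simpa using (summable_nat_add_iff 1).mpr (summable_geometric_of_lt_one (norm_nonneg _) hq))
  simpa [qPochInf, sub_eq_add_neg] using this

lemma qPoch_bound {q : ℂ} (hq : ‖q‖ < 1) : ∃ C : ℝ, ∀ n, ‖(qPoch q n)⁻¹‖ ≤ C := by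
  have h := ((qPoch_tendsto hq).inv₀ (qPochInf_ne hq)).norm
  obtain ⟨C, hC⟩ := h.bddAbove_range
  exact ⟨C, fun n => hC ⟨n, rfl⟩⟩

lemma euler1 {q : ℂ} (hq : ‖q‖ < 1) (m : ℕ) :
    ∑' n, (qPoch q n)⁻¹ * q ^ (n * (m + 1)) = qPoch q m / qPochInf q := by
  obtain ⟨C, hC⟩ := qPoch_bound hq
  set F : ℕ → ℂ := fun m => ∑' n, (qPoch q n)⁻¹ * q ^ (n * (m + 1)) with hF
  have hs := fun m => aux_summ hC hq m
  have hrec : ∀ m, F (m + 1) = F m * (1 - q ^ (m + 1)) := by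
    intro m
    have h1 : F m - F (m + 1) = q ^ (m + 1) * F m := by
      simp only [hF]
      rw [← (hs m).tsum_sub (hs (m + 1)), ((hs m).sub (hs (m + 1))).tsum_eq_zero_add,
        ← tsum_mul_left]
      simp only [zero_mul, pow_zero, sub_self, zero_add]
      refine tsum_congr fun n => ?_
      have e1 := qPoch_ne hq n
      have e2 := one_sub_ne hq n
      rw [qPoch_succ]
      field_simp
      ring
    linear_combination -h1
  have hF0 : ∀ m, F m = F 0 * qPoch q m := by
    intro m
    induction m with
    | zero => simp [qPoch]
    | succ k ih => rw [hrec, ih, qPoch_succ]; ring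
  have hl : Tendsto F atTop (𝓝 1) := by
    have h := aux_lim hC hq
    have e0 : qPoch q 0 = 1 := by simp [qPoch]
    simpa [e0] using h
  have hl2 : Tendsto F atTop (𝓝 (F 0 * qPochInf q)) :=
    ((qPoch_tendsto hq).const_mul (F 0)).congr fun m => (hF0 m).symm
  have h3 := tendsto_nhds_unique hl hl2
  show F m = _
  rw [hF0, eq_div_iff (qPochInf_ne hq)]
  linear_combination -(qPoch q m) * h3

lemma bbound {q : ℂ} (hq : ‖q‖ < 1) {C : ℝ} (hC : ∀ n, ‖(qPoch q n)⁻¹‖ ≤ C) (k : ℕ) :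
    ‖(-1) ^ k * q ^ (k.choose 2) * (qPoch q k)⁻¹‖ ≤ C := by
  rw [norm_mul, norm_mul, norm_pow, norm_pow, norm_neg, norm_one, one_pow, one_mul]
  have h1 : ‖q‖ ^ (k.choose 2) ≤ 1 := pow_le_one₀ (norm_nonneg _) hq.le
  calc _ ≤ 1 * ‖(qPoch q k)⁻¹‖ := mul_le_mul_of_nonneg_right h1 (norm_nonneg _)
    _ ≤ C := by rw [one_mul]; exact hC k

lemma euler2 {q : ℂ} (hq : ‖q‖ < 1) (m : ℕ) :
    ∑' k, ((-1) ^ k * q ^ (k.choose 2) * (qPoch q k)⁻¹) * q ^ (k * (m + 1))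
      = qPochInf q / qPoch q m := by
  obtain ⟨C, hC'⟩ := qPoch_bound hq
  have hC := bbound hq hC'
  set F : ℕ → ℂ := fun m =>
    ∑' k, ((-1) ^ k * q ^ (k.choose 2) * (qPoch q k)⁻¹) * q ^ (k * (m + 1)) with hF
  have hs := fun m => aux_summ hC hq m
  have hrec : ∀ m, F m = F (m + 1) * (1 - q ^ (m + 1)) := by
    intro m
    have h1 : F m - F (m + 1) = -q ^ (m + 1) * F (m + 1) := by
      simp only [hF]
      rw [← (hs m).tsum_sub (hs (m + 1)), ((hs m).sub (hs (m + 1))).tsum_eq_zero_add,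
        ← tsum_mul_left]
      simp only [zero_mul, pow_zero, sub_self, zero_add]
      refine tsum_congr fun n => ?_
      have e1 := qPoch_ne hq n
      have e2 := one_sub_ne hq n
      have e3 : (n + 1).choose 2 = n + n.choose 2 := by
        rw [Nat.choose_succ_succ' n 1, Nat.choose_one_right]
      rw [qPoch_succ, e3]
      field_simp
      ring
    linear_combination h1
  have hF0 : ∀ m, F 0 = F m * qPoch q m := by
    intro m
    induction m with
    | zero => simp [qPoch]
    | succ k ih => rw [ih, hrec, qPoch_succ]; ring
  have hl : Tendsto F atTop (𝓝 1) := by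
    have h := aux_lim hC hq
    have e0 : qPoch q 0 = 1 := by simp [qPoch]
    simpa [e0] using h
  have hl2 : Tendsto (fun m => F m * qPoch q m) atTop (𝓝 (1 * qPochInf q)) :=
    hl.mul (qPoch_tendsto hq)
  have h3 : F 0 = 1 * qPochInf q :=
    tendsto_nhds_unique (tendsto_const_nhds.congr fun m => hF0 m) hl2
  show F m = _
  rw [eq_div_iff (qPoch_ne hq m), ← hF0, h3, one_mul]

lemma single_sum {q : ℂ} (hq : ‖q‖ < 1) :
    ∑' n, q ^ n * (qPoch q n)⁻¹ * (qPoch q (n + 1))⁻¹ =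
      (∑' n : ℕ, (-1 : ℂ) ^ n * q ^ (n * (n + 3) / 2)) / qPochInf q ^ 2 := by
  obtain ⟨C, hC⟩ := qPoch_bound hq
  have hP := qPochInf_ne hq
  have hg := summable_geometric_of_lt_one (norm_nonneg q) hq
  have hC0 : 0 ≤ C := (norm_nonneg _).trans (hC 0)
  set b : ℕ → ℂ := fun k => (-1) ^ k * q ^ (k.choose 2) * (qPoch q k)⁻¹ with hb
  have hbC : ∀ k, ‖b k‖ ≤ C := bbound hq hC
  let T : ℕ → ℕ → ℂ := fun n k => q ^ n * (qPoch q n)⁻¹ * (b k * q ^ (k * (n + 1 + 1)))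
  have hT : Summable (Function.uncurry T) := by
    refine Summable.of_norm_bounded (g := fun x : ℕ × ℕ => (C * C) * (‖q‖ ^ x.1 * ‖q‖ ^ x.2))
      ((hg.mul_of_nonneg hg (fun _ => by positivity) (fun _ => by positivity)).mul_left _) ?_
    rintro ⟨n, k⟩
    simp only [Function.uncurry, T, norm_mul, norm_pow]
    have h1 : ‖q‖ ^ (k * (n + 1 + 1)) ≤ ‖q‖ ^ k :=
      pow_le_pow_of_le_one (norm_nonneg _) hq.le (by nlinarith [Nat.zero_le (k * n)])
    calc _ ≤ ‖q‖ ^ n * C * (C * ‖q‖ ^ k) := by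
          gcongr
          · exact hC n
          · exact hbC k
      _ = _ := by ring
  have h1 : ∀ n, q ^ n * (qPoch q n)⁻¹ * (qPoch q (n + 1))⁻¹ = (qPochInf q)⁻¹ * ∑' k, T n k := by
    intro n
    simp only [T]
    rw [tsum_mul_left, euler2 hq (n + 1)]
    field_simp
  have h2 : ∀ k, ∑' n, T n k = (-1 : ℂ) ^ k * q ^ (k * (k + 3) / 2) * (qPochInf q)⁻¹ := by
    intro k
    have : ∀ n, T n k = (b k * q ^ (2 * k)) * ((qPoch q n)⁻¹ * q ^ (n * (k + 1))) := by
      intro n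
      simp only [T]
      ring
    simp_rw [this]
    rw [tsum_mul_left, euler1 hq k]
    have e : k * (k + 3) / 2 = k.choose 2 + 2 * k := by
      rw [Nat.choose_two_right]
      rcases k with _ | k
      · simp
      · rw [show (k + 1) * (k + 1 + 3) = (k + 1) * (k + 1 - 1) + 2 * (2 * (k + 1)) by
          simp; ring]
        rw [Nat.add_mul_div_left _ _ (by norm_num)]
    have e1 := qPoch_ne hq k
    rw [e, pow_add]
    simp only [hb]
    field_simp
  simp_rw [h1]
  rw [tsum_mul_left, ← hT.tsum_comm]
  simp_rw [h2]
  rw [tsum_mul_right]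
  field_simp

theorem stmt5 (q : ℂ) (hq : ‖q‖ < 1) :
    ∑' n : ℕ × ℕ × ℕ,
        q ^ (n.1 + n.2.1 + n.2.2 + n.1 * n.2.1 + n.2.1 * n.2.2)
          / (qPoch q n.1 * qPoch q n.2.1 * qPoch q n.2.2 ^ 2)
      = (∑' n : ℕ, (-1 : ℂ) ^ n * q ^ (n * (n + 3) / 2)) / qPochInf q ^ 3 := by
  obtain ⟨C, hC⟩ := qPoch_bound hq
  have hP := qPochInf_ne hq
  have hg := summable_geometric_of_lt_one (norm_nonneg q) hq
  have hC0 : 0 ≤ C := (norm_nonneg _).trans (hC 0)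
  let T : (ℕ × ℕ) × ℕ → ℂ := fun x =>
    (q ^ (x.1.1 + x.1.2 + x.1.1 * x.1.2) * (qPoch q x.1.1)⁻¹ * ((qPoch q x.1.2)⁻¹) ^ 2) *
      ((qPoch q x.2)⁻¹ * q ^ (x.2 * (x.1.1 + 1)))
  have hT : Summable T := by
    refine Summable.of_norm_bounded
      (g := fun x : (ℕ × ℕ) × ℕ => (C ^ 4) * ((‖q‖ ^ x.1.1 * ‖q‖ ^ x.1.2) * ‖q‖ ^ x.2))
      (((hg.mul_of_nonneg hg (fun _ => by positivity) (fun _ => by positivity)).mul_of_nonneg hg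
        (fun _ => by positivity) (fun _ => by positivity)).mul_left _) ?_
    rintro ⟨⟨n, k⟩, l⟩
    simp only [T, norm_mul, norm_pow]
    have h1 : ‖q‖ ^ (n + k + n * k) ≤ ‖q‖ ^ (n + k) :=
      pow_le_pow_of_le_one (norm_nonneg _) hq.le (by nlinarith [Nat.zero_le (k * n)])
    have h2 : ‖q‖ ^ (l * (n + 1)) ≤ ‖q‖ ^ l :=
      pow_le_pow_of_le_one (norm_nonneg _) hq.le (by nlinarith [Nat.zero_le (l * n)])
    calc _ ≤ ‖q‖ ^ (n + k) * C * C ^ 2 * (C * ‖q‖ ^ l) := by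
          gcongr
          · exact hC n
          · exact hC k
          · exact hC l
      _ = _ := by ring
  have h1 : ∀ x : ℕ × ℕ, ∑' l, T (x, l) =
      (qPochInf q)⁻¹ * (((qPoch q x.2)⁻¹) ^ 2 * q ^ x.2 * (q ^ (x.2 + 1)) ^ x.1) := by
    rintro ⟨n, k⟩
    simp only [T]
    rw [tsum_mul_left, euler1 hq n]
    have e1 := qPoch_ne hq n
    field_simp
    ring
  let e : ℕ × ℕ × ℕ ≃ (ℕ × ℕ) × ℕ := (Equiv.prodComm ℕ (ℕ × ℕ))
  have h0 : ∑' n : ℕ × ℕ × ℕ,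
        q ^ (n.1 + n.2.1 + n.2.2 + n.1 * n.2.1 + n.2.1 * n.2.2)
          / (qPoch q n.1 * qPoch q n.2.1 * qPoch q n.2.2 ^ 2) = ∑' x, T x := by
    rw [← e.tsum_eq T]
    refine tsum_congr ?_
    rintro ⟨a, b, c⟩
    simp only [T, e, Equiv.prodComm_apply, Prod.swap]
    rw [div_eq_mul_inv, mul_inv, mul_inv, inv_pow]
    ring
  have hT1 : Summable fun x : ℕ × ℕ => ∑' l, T (x, l) := hT.prod
  rw [h0, hT.tsum_prod]
  have hT2 : Summable fun x : ℕ × ℕ => ∑' l, T (x.swap, l) :=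
    (Equiv.prodComm ℕ ℕ).summable_iff.mpr hT1
  rw [← (Equiv.prodComm ℕ ℕ).tsum_eq (fun x : ℕ × ℕ => ∑' l, T (x, l))]
  simp only [Equiv.prodComm_apply]
  rw [hT2.tsum_prod]
  have h3 : ∀ k, ∑' n, ∑' l, T ((k, n).swap, l) =
      (qPochInf q)⁻¹ * (q ^ k * (qPoch q k)⁻¹ * (qPoch q (k + 1))⁻¹) := by
    intro k
    simp_rw [h1]
    simp only [Prod.swap]
    rw [tsum_mul_left, tsum_mul_left, tsum_geometric_of_norm_lt_one, qPoch_succ, mul_inv]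
    · ring
    · rw [norm_pow]; exact pow_lt_one₀ (norm_nonneg _) hq (by omega)
  simp_rw [h3]
  rw [tsum_mul_left, single_sum hq]
  field_simp
end

section
/- For |q| < 1, the 5-fold sum ∑_{n₁,…,n₅≥0} q^{n₁+⋯+n₅+n₁n₂+n₂n₃+n₃n₄+n₄n₅} / ((q;q)_{n₁}⋯(q;q)_{n₅}) equals 1/(q;q)_∞² · ∑_{n≥0} qⁿ/((q;q)_n (1-q^{n+1})²). -/
open Filter Topology

lemma aux_pow_ne (q : ℂ) (hq : ‖q‖ < 1) (n : ℕ) : 1 - q ^ (n + 1) ≠ 0 := by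
  intro h
  have h1 : q ^ (n + 1) = 1 := (sub_eq_zero.mp h).symm
  have h2 : ‖q‖ ^ (n + 1) = 1 := by rw [← norm_pow, h1, norm_one]
  exact absurd h2 (pow_lt_one₀ (norm_nonneg q) hq (Nat.succ_ne_zero n)).ne

lemma aux_poch_ne (q : ℂ) (hq : ‖q‖ < 1) (n : ℕ) : qPoch q n ≠ 0 :=
  Finset.prod_ne_zero_iff.mpr fun i _ => aux_pow_ne q hq i

lemma aux_summable (q : ℂ) (hq : ‖q‖ < 1) : Summable fun i : ℕ => ‖-q ^ (i + 1)‖ := by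
  simp only [norm_neg, norm_pow]
  exact (summable_nat_add_iff 1).mpr (summable_geometric_of_lt_one (norm_nonneg q) hq)

lemma aux_tendsto (q : ℂ) (hq : ‖q‖ < 1) :
    Tendsto (qPoch q) atTop (𝓝 (qPochInf q)) := by
  have h := (multipliable_one_add_of_summable (aux_summable q hq)).hasProd.tendsto_prod_nat
  simp only [← sub_eq_add_neg] at h
  exact h

lemma aux_inf_ne (q : ℂ) (hq : ‖q‖ < 1) : qPochInf q ≠ 0 := by
  have h := tprod_one_add_ne_zero_of_summable (f := fun i : ℕ => -q ^ (i + 1))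
    (fun i => by simpa only [sub_eq_add_neg] using aux_pow_ne q hq i) (aux_summable q hq)
  simpa only [qPochInf, sub_eq_add_neg] using h

lemma aux_bound (q : ℂ) (hq : ‖q‖ < 1) : ∃ C : ℝ, 0 ≤ C ∧ ∀ n, ‖(qPoch q n)⁻¹‖ ≤ C := by
  have h := (aux_tendsto q hq).inv₀ (aux_inf_ne q hq)
  obtain ⟨C, hC⟩ := (Metric.isBounded_range_of_tendsto _ h).exists_norm_le
  exact ⟨C, (norm_nonneg _).trans (hC _ ⟨0, rfl⟩), fun n => hC _ ⟨n, rfl⟩⟩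

lemma aux_term_le (q : ℂ) (hq : ‖q‖ < 1) {C : ℝ} (hC : ∀ n, ‖(qPoch q n)⁻¹‖ ≤ C) (n m : ℕ) :
    ‖q ^ (n * (m + 1)) / qPoch q n‖ ≤ ‖q‖ ^ n * C := by
  rw [div_eq_mul_inv, norm_mul, norm_pow]
  refine mul_le_mul ?_ (hC n) (norm_nonneg _) (by positivity)
  exact pow_le_pow_of_le_one (norm_nonneg q) hq.le (by nlinarith)

lemma aux_bsum (q : ℂ) (hq : ‖q‖ < 1) (C : ℝ) : Summable fun n : ℕ => ‖q‖ ^ n * C :=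
  (summable_geometric_of_lt_one (norm_nonneg q) hq).mul_right C

lemma aux_Fsum (q : ℂ) (hq : ‖q‖ < 1) (m : ℕ) :
    Summable fun n : ℕ => q ^ (n * (m + 1)) / qPoch q n := by
  obtain ⟨C, _, hC⟩ := aux_bound q hq
  exact Summable.of_norm_bounded (aux_bsum q hq C) fun n => aux_term_le q hq hC n m

lemma aux_rec (q : ℂ) (hq : ‖q‖ < 1) (m : ℕ) :
    ∑' n : ℕ, q ^ (n * (m + 1 + 1)) / qPoch q n
      = (1 - q ^ (m + 1)) * ∑' n : ℕ, q ^ (n * (m + 1)) / qPoch q n := by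
  have h0 := aux_Fsum q hq m
  have h1 := aux_Fsum q hq (m + 1)
  have h : ∑' n : ℕ, (q ^ (n * (m + 1)) / qPoch q n - q ^ (n * (m + 1 + 1)) / qPoch q n)
      = q ^ (m + 1) * ∑' n : ℕ, q ^ (n * (m + 1)) / qPoch q n := by
    rw [(h0.sub h1).tsum_eq_zero_add, ← tsum_mul_left]
    simp only [zero_mul, pow_zero, sub_self, zero_add]
    refine tsum_congr fun n => ?_
    have e : qPoch q (n + 1) = qPoch q n * (1 - q ^ (n + 1)) := Finset.prod_range_succ _ _
    have a := aux_poch_ne q hq n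
    have b := aux_pow_ne q hq n
    rw [e]
    field_simp
    ring
  rw [h0.tsum_sub h1] at h
  linear_combination -h

lemma aux_F (q : ℂ) (hq : ‖q‖ < 1) (m : ℕ) :
    ∑' n : ℕ, q ^ (n * (m + 1)) / qPoch q n
      = qPoch q m * ∑' n : ℕ, q ^ (n * (0 + 1)) / qPoch q n := by
  induction m with
  | zero => simp [qPoch]
  | succ m ih =>
    have e : qPoch q (m + 1) = qPoch q m * (1 - q ^ (m + 1)) := Finset.prod_range_succ _ _
    rw [aux_rec q hq, ih, e]
    ring

lemma aux_F0 (q : ℂ) (hq : ‖q‖ < 1) :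
    ∑' n : ℕ, q ^ (n * (0 + 1)) / qPoch q n = (qPochInf q)⁻¹ := by
  obtain ⟨C, _, hC⟩ := aux_bound q hq
  have l1 : Tendsto (fun m : ℕ => ∑' n : ℕ, q ^ (n * (m + 1)) / qPoch q n) atTop
      (𝓝 (∑' n : ℕ, if n = 0 then (1 : ℂ) else 0)) := by
    refine tendsto_tsum_of_dominated_convergence (aux_bsum q hq C) (fun n => ?_)
      (Eventually.of_forall fun m n => aux_term_le q hq hC n m)
    rcases Nat.eq_zero_or_pos n with rfl | hn
    · simp [qPoch]
    · rw [if_neg hn.ne']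
      have hn1 : ‖q ^ n‖ < 1 := by
        rw [norm_pow]; exact pow_lt_one₀ (norm_nonneg q) hq hn.ne'
      have := ((tendsto_pow_atTop_nhds_zero_of_norm_lt_one hn1).comp
        (tendsto_add_atTop_nat 1)).div_const (qPoch q n)
      simpa only [Function.comp_def, ← pow_mul, zero_div] using this
  rw [tsum_ite_eq] at l1
  have l2 := (aux_tendsto q hq).mul_const (∑' n : ℕ, q ^ (n * (0 + 1)) / qPoch q n)
  simp only [← aux_F q hq] at l2
  exact eq_inv_of_mul_eq_one_right (tendsto_nhds_unique l2 l1)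

lemma aux_euler (q : ℂ) (hq : ‖q‖ < 1) (m : ℕ) :
    ∑' n : ℕ, q ^ (n * (m + 1)) / qPoch q n = qPoch q m * (qPochInf q)⁻¹ := by
  rw [aux_F q hq, aux_F0 q hq]

lemma aux_geom (q : ℂ) (hq : ‖q‖ < 1) (m : ℕ) :
    ∑' n : ℕ, q ^ (n * (m + 1)) = (1 - q ^ (m + 1))⁻¹ := by
  have h1 : ‖q ^ (m + 1)‖ < 1 := by
    rw [norm_pow]; exact pow_lt_one₀ (norm_nonneg q) hq (Nat.succ_ne_zero m)
  rw [← tsum_geometric_of_norm_lt_one h1]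
  exact tsum_congr fun n => by rw [← pow_mul, mul_comm]

/-- reordering equivalence -/
def auxEquiv : ℕ × ℕ × ℕ × ℕ × ℕ ≃ (Fin 5 → ℕ) where
  toFun p := ![p.2.2.1, p.2.1, p.1, p.2.2.2.1, p.2.2.2.2]
  invFun n := (n 2, n 1, n 0, n 3, n 4)
  left_inv p := by simp
  right_inv n := by
    ext i
    fin_cases i <;> rfl

/-- one factor -/
noncomputable def auxT (q : ℂ) (n m : ℕ) : ℂ := q ^ (n * (m + 1)) / qPoch q n

lemma aux_sum5 (q : ℂ) (hq : ‖q‖ < 1) : Summable fun p : ℕ × ℕ × ℕ × ℕ × ℕ =>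
    auxT q p.1 0 * (auxT q p.2.1 p.1 * (auxT q p.2.2.1 p.2.1 *
      (auxT q p.2.2.2.1 p.1 * auxT q p.2.2.2.2 p.2.2.2.1))) := by
  obtain ⟨C, hC0, hC⟩ := aux_bound q hq
  have b := aux_bsum q hq C
  have nn : ∀ n : ℕ, 0 ≤ ‖q‖ ^ n * C := fun n => by positivity
  have b2 := b.mul_of_nonneg b nn nn
  have n2 : ∀ p : ℕ × ℕ, 0 ≤ (‖q‖ ^ p.1 * C) * (‖q‖ ^ p.2 * C) := fun n => by positivity
  have b3 := b.mul_of_nonneg b2 nn n2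
  have b4 := b.mul_of_nonneg b3 nn (fun n => by positivity)
  have b5 := b.mul_of_nonneg b4 nn (fun n => by positivity)
  refine Summable.of_norm_bounded b5 fun p => ?_
  have t := fun n m => aux_term_le q hq hC n m
  simp only [norm_mul]
  unfold auxT
  gcongr <;> apply t

theorem stmt10 (q : ℂ) (hq : ‖q‖ < 1) :
    ∑' n : Fin 5 → ℕ,
        q ^ (n 0 + n 1 + n 2 + n 3 + n 4 + n 0 * n 1 + n 1 * n 2 + n 2 * n 3 + n 3 * n 4)
          / (qPoch q (n 0) * qPoch q (n 1) * qPoch q (n 2) * qPoch q (n 3) * qPoch q (n 4))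
      = 1 / qPochInf q ^ 2 *
          ∑' n : ℕ, q ^ n / (qPoch q n * (1 - q ^ (n + 1)) ^ 2) := by
  have hs := aux_sum5 q hq
  rw [← auxEquiv.tsum_eq]
  have key : ∀ n m, qPoch q n * auxT q n m = q ^ (n * (m + 1)) := fun n m => by
    unfold auxT; exact mul_div_cancel₀ _ (aux_poch_ne q hq n)
  have eul : ∀ m, ∑' n, auxT q n m = qPoch q m * (qPochInf q)⁻¹ := aux_euler q hq
  have main : ∑' p : ℕ × ℕ × ℕ × ℕ × ℕ,
      auxT q p.1 0 * (auxT q p.2.1 p.1 * (auxT q p.2.2.1 p.2.1 *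
      (auxT q p.2.2.2.1 p.1 * auxT q p.2.2.2.2 p.2.2.2.1)))
      = 1 / qPochInf q ^ 2 *
          ∑' n : ℕ, q ^ n / (qPoch q n * (1 - q ^ (n + 1)) ^ 2) := by
    rw [hs.tsum_prod, ← tsum_mul_left]
    refine tsum_congr fun c => ?_
    have h1 := hs.prod_factor c
    rw [h1.tsum_prod]
    have hb : ∀ b : ℕ, ∑' x : ℕ × ℕ × ℕ, auxT q c 0 * (auxT q b c * (auxT q x.1 b *
        (auxT q x.2.1 c * auxT q x.2.2 x.2.1)))
        = auxT q c 0 * (q ^ (b * (c + 1)) * ((qPochInf q)⁻¹ *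
          ((qPochInf q)⁻¹ * (1 - q ^ (c + 1))⁻¹))) := by
      intro b
      have h2 := h1.prod_factor b
      rw [h2.tsum_prod]
      have ha : ∀ a : ℕ, ∑' x : ℕ × ℕ, auxT q c 0 * (auxT q b c * (auxT q a b *
        (auxT q x.1 c * auxT q x.2 x.1))) = auxT q c 0 * (auxT q b c * (auxT q a b *
          ((qPochInf q)⁻¹ * (1 - q ^ (c + 1))⁻¹))) := by
        intro a
        have h3 := h2.prod_factor a
        rw [h3.tsum_prod]
        simp only [tsum_mul_left, eul]
        have : ∀ d, auxT q d c * (qPoch q d * (qPochInf q)⁻¹)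
            = (qPochInf q)⁻¹ * q ^ (d * (c + 1)) := fun d => by
          rw [← key]; ring
        simp only [this, tsum_mul_left, aux_geom q hq]
      simp only [ha, tsum_mul_left, tsum_mul_right, eul]
      rw [← key]; ring
    simp only [hb, tsum_mul_left, tsum_mul_right, aux_geom q hq]
    have a1 := aux_poch_ne q hq c
    have a2 := aux_inf_ne q hq
    have a3 := aux_pow_ne q hq c
    unfold auxT
    field_simp
    simp
  rw [← main]
  refine tsum_congr fun p => ?_
  obtain ⟨c, b, a, d, e⟩ := p
  have a1 := aux_poch_ne q hq a
  have a2 := aux_poch_ne q hq b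
  have a3 := aux_poch_ne q hq c
  have a4 := aux_poch_ne q hq d
  have a5 := aux_poch_ne q hq e
  change q ^ (a + b + c + d + e + a * b + b * c + c * d + d * e) /
    (qPoch q a * qPoch q b * qPoch q c * qPoch q d * qPoch q e) =
    auxT q c 0 * (auxT q b c * (auxT q a b * (auxT q d c * auxT q e d)))
  unfold auxT
  simp only [div_mul_div_comm, ← pow_add]
  congr 1
  · congr 1; ring
  · ring
end
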